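/- arXiv:2404.14365 — 2 statements merged into one kernel-verified Lean document; each statement's English description precedes it below -/
import Mathlib

section
/- Let k ≥ 1 and let Q_0, …, Q_k ∈ ℂ[x] with deg Q_k ≥ 1, and let T(p) = ∑_{j=0}^k Q_j · p^{(j)}. Then for every integer n ≥ 0 the family of nonempty closed T_{≥n}-invariant subsets of ℂ has a unique minimal element under inclusion: the intersection M of all nonempty closed T_{≥n}-invariant subsets of ℂ is nonempty (it contains the convex hull of the zeros of Q_k), closed, T_{≥n}-invariant, and contained in every nonempty closed T_{≥n}-invariant set. -/
open Polynomial

/-- The differential operator `T(p) = ∑_{j=0}^k Q_j · p^{(j)}`. -/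
noncomputable def diffOp (k : ℕ) (Q : ℕ → Polynomial ℂ) (p : Polynomial ℂ) : Polynomial ℂ :=
  ∑ j ∈ Finset.range (k + 1), Q j * (⇑(Polynomial.derivative (R := ℂ)))^[j] p

/-- A set `S ⊆ ℂ` is `T_{≥n}`-invariant: for every nonzero polynomial `p` with `deg p ≥ n`
all of whose zeros lie in `S`, either `T p = 0` or all zeros of `T p` lie in `S`. -/
def TGeInvariant (T : Polynomial ℂ → Polynomial ℂ) (n : ℕ) (S : Set ℂ) : Prop :=
  ∀ p : Polynomial ℂ, p ≠ 0 → n ≤ p.natDegree → (∀ z : ℂ, p.eval z = 0 → z ∈ S) →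
    T p = 0 ∨ ∀ z : ℂ, (T p).eval z = 0 → z ∈ S

/-- A closed set that contains the midpoint of any two of its points is convex. -/
theorem IsClosed.convex_of_midpoint_mem {E : Type*} [AddCommGroup E] [Module ℝ E]
    [TopologicalSpace E] [ContinuousAdd E] [ContinuousSMul ℝ E] {S : Set E} (hS : IsClosed S)
    (hmid : ∀ a ∈ S, ∀ b ∈ S, (2⁻¹ : ℝ) • (a + b) ∈ S) : Convex ℝ S := by
  rw [convex_iff_add_mem]
  intro a ha b hb u v hu hv huv
  let line : ℝ → E := fun t => (1 - t) • a + t • b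
  have hline : Continuous line := by fun_prop
  have hmid_line : ∀ s t, line s ∈ S → line t ∈ S → line (2⁻¹ * (s + t)) ∈ S := by
    intro s t hs ht
    convert hmid _ hs _ ht using 1
    simp only [line]
    module
  have hsub : Set.Icc (0 : ℝ) 1 ⊆ line ⁻¹' S := by
    refine IsClosed.Icc_subset_of_forall_exists_gt ((hS.preimage hline).inter isClosed_Icc)
      (by simpa [line] using ha) ?_
    rintro x ⟨hx, hx0, hx1⟩ y hy
    have hbisect : ∀ N : ℕ, line (x + (2⁻¹ : ℝ) ^ N * (1 - x)) ∈ S := by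
      intro N
      induction N with
      | zero => simpa [line] using hb
      | succ N ih =>
        convert hmid_line _ _ hx ih using 2
        ring
    obtain ⟨N, hN⟩ := exists_pow_lt_of_lt_one (sub_pos.2 hy) (by norm_num : (2⁻¹ : ℝ) < 1)
    have hpos : (0 : ℝ) < 2⁻¹ ^ N := by positivity
    refine ⟨_, hbisect N, ?_, ?_⟩
    · nlinarith
    · nlinarith
  have hv1 : v ∈ Set.Icc (0 : ℝ) 1 := ⟨hv, by linarith⟩
  have := hsub hv1
  rwa [Set.mem_preimage, show line v = u • a + v • b by simp [line, ← huv]] at this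

namespace Polynomial

/-- A polynomial of degree at most `D` without zeros in the ball of radius `r` about `w` grows at
most by the factor `2 ^ D` on that ball. -/
theorem norm_eval_le_of_forall_root_dist {p : ℂ[X]} {D : ℕ} (hD : p.natDegree ≤ D) {w y : ℂ}
    {r : ℝ} (hroot : ∀ z, p.eval z = 0 → r ≤ ‖w - z‖) (hy : ‖y - w‖ ≤ r) :
    ‖p.eval y‖ ≤ 2 ^ D * ‖p.eval w‖ := by
  rcases eq_or_ne p 0 with rfl | hp
  · simp
  have hsplit := IsAlgClosed.splits p
  have hprod : ∀ s : Multiset ℂ, (∀ z ∈ s, r ≤ ‖w - z‖) →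
      ‖(s.map (y - ·)).prod‖ ≤ 2 ^ s.card * ‖(s.map (w - ·)).prod‖ := by
    intro s
    induction s using Multiset.induction_on with
    | empty => simp
    | cons z s ih =>
      intro h
      have hz : ‖y - z‖ ≤ 2 * ‖w - z‖ := by
        have h1 := norm_add_le (y - w) (w - z)
        have h2 := h z (Multiset.mem_cons_self z s)
        rw [sub_add_sub_cancel] at h1
        linarith
      have hs := ih fun x hx => h x (Multiset.mem_cons_of_mem hx)
      simp only [Multiset.map_cons, Multiset.prod_cons, norm_mul, Multiset.card_cons]
      calc _ ≤ (2 * ‖w - z‖) * (2 ^ s.card * ‖(s.map (w - ·)).prod‖) := by gcongr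
        _ = _ := by ring
  have hle := hprod p.roots fun z hz => hroot z ((mem_roots hp).1 hz)
  rw [hsplit.eval_eq_prod_roots, hsplit.eval_eq_prod_roots, norm_mul, norm_mul]
  calc _ ≤ ‖p.leadingCoeff‖ * (2 ^ p.roots.card * ‖(p.roots.map (w - ·)).prod‖) := by gcongr
    _ ≤ ‖p.leadingCoeff‖ * (2 ^ D * ‖(p.roots.map (w - ·)).prod‖) := by
      gcongr
      · norm_num
      · exact (card_roots' p).trans hD
    _ = _ := by ring

/-- A family of polynomials of bounded degree whose coefficients depend continuously on the
parameter. -/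
def IsContinuousFamily (f : ℂ → ℂ[X]) : Prop :=
  (∃ D, ∀ t, (f t).natDegree ≤ D) ∧ ∀ i, Continuous fun t => (f t).coeff i

namespace IsContinuousFamily

variable {f g : ℂ → ℂ[X]}

theorem const (p : ℂ[X]) : IsContinuousFamily fun _ => p :=
  ⟨⟨p.natDegree, fun _ => le_rfl⟩, fun _ => continuous_const⟩

theorem C_comp {c : ℂ → ℂ} (hc : Continuous c) : IsContinuousFamily fun t => C (c t) := by
  refine ⟨⟨0, fun t => by simp⟩, fun i => ?_⟩
  simp only [coeff_C]
  split_ifs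
  · exact hc
  · exact continuous_const

theorem add (hf : IsContinuousFamily f) (hg : IsContinuousFamily g) :
    IsContinuousFamily fun t => f t + g t := by
  obtain ⟨⟨D, hD⟩, hf⟩ := hf
  obtain ⟨⟨E, hE⟩, hg⟩ := hg
  refine ⟨⟨max D E, fun t => (natDegree_add_le _ _).trans (max_le_max (hD t) (hE t))⟩, fun i => ?_⟩
  simp only [coeff_add]
  exact (hf i).add (hg i)

theorem mul (hf : IsContinuousFamily f) (hg : IsContinuousFamily g) :
    IsContinuousFamily fun t => f t * g t := by
  obtain ⟨⟨D, hD⟩, hf⟩ := hf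
  obtain ⟨⟨E, hE⟩, hg⟩ := hg
  refine ⟨⟨D + E, fun t => natDegree_mul_le.trans (add_le_add (hD t) (hE t))⟩, fun i => ?_⟩
  simp only [coeff_mul]
  exact continuous_finsetSum _ fun x _ => (hf x.1).mul (hg x.2)

theorem derivative (hf : IsContinuousFamily f) :
    IsContinuousFamily fun t => Polynomial.derivative (f t) := by
  obtain ⟨⟨D, hD⟩, hf⟩ := hf
  refine ⟨⟨D, fun t => (natDegree_derivative_le _).trans ((Nat.sub_le _ _).trans (hD t))⟩,
    fun i => ?_⟩
  simp only [coeff_derivative]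
  exact (hf (i + 1)).mul continuous_const

theorem sum {ι : Type*} (s : Finset ι) {F : ι → ℂ → ℂ[X]}
    (hF : ∀ i ∈ s, IsContinuousFamily (F i)) : IsContinuousFamily fun t => ∑ i ∈ s, F i t := by
  classical
  induction s using Finset.induction_on with
  | empty => simpa using const 0
  | insert i s hi ih =>
    simp only [Finset.sum_insert hi]
    exact (hF i (Finset.mem_insert_self i s)).add
      (ih fun j hj => hF j (Finset.mem_insert_of_mem hj))

theorem continuous_eval (hf : IsContinuousFamily f) (y : ℂ) :
    Continuous fun t => (f t).eval y := by
  obtain ⟨⟨D, hD⟩, hf⟩ := hf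
  simp only [fun t => eval_eq_sum_range' (Nat.lt_succ_of_le (hD t)) y]
  exact continuous_finsetSum _ fun i _ => (hf i).mul continuous_const

/-- If the zeros of `f (t i)` lie in a closed set along a sequence of parameters `t i → 0`, then
so do the zeros of `f 0`, unless `f 0 = 0`. -/
theorem root_mem_of_tendsto (hf : IsContinuousFamily f) (h0 : f 0 ≠ 0) {S : Set ℂ}
    (hS : IsClosed S) {t : ℕ → ℂ} (ht : Filter.Tendsto t Filter.atTop (nhds 0))
    (hroot : ∀ᶠ m in Filter.atTop, f (t m) = 0 ∨ ∀ z, (f (t m)).eval z = 0 → z ∈ S)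
    {w : ℂ} (hw : (f 0).eval w = 0) : w ∈ S := by
  by_contra hwS
  obtain ⟨r, hr, hball⟩ := Metric.isOpen_iff.1 hS.isOpen_compl w hwS
  obtain ⟨D, hD⟩ := hf.1
  have hlim : ∀ y, Filter.Tendsto (fun m => (f (t m)).eval y) Filter.atTop
      (nhds ((f 0).eval y)) := fun y => ((hf.continuous_eval y).tendsto 0).comp ht
  have hzero : ∀ y ∈ Metric.ball w r, (f 0).IsRoot y := by
    intro y hy
    have hle : ‖(f 0).eval y‖ ≤ 2 ^ D * ‖(f 0).eval w‖ := by
      refine le_of_tendsto_of_tendsto (hlim y).norm ((hlim w).norm.const_mul _) ?_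
      filter_upwards [hroot] with m hm
      rcases hm with hm | hm
      · simp [hm]
      · refine norm_eval_le_of_forall_root_dist (hD _) (r := r) (fun z hz => ?_)
          (by simpa [dist_eq_norm] using (Metric.mem_ball.1 hy).le)
        by_contra! hlt
        exact hball (by rwa [Metric.mem_ball, dist_comm, dist_eq_norm]) (hm z hz)
    simpa [hw] using hle
  refine h0 (eq_zero_of_infinite_isRoot _ (Set.Infinite.mono hzero ?_))
  exact infinite_of_mem_nhds w (Metric.ball_mem_nhds w hr)

end IsContinuousFamily

/-- The polynomials `r j t` such that the `j`-th derivative of `g ^ m` equals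
`m ^ j * g ^ (m - j) * r j (1 / m)`. -/
noncomputable def powDerivFactor (g : ℂ[X]) : ℕ → ℂ → ℂ[X]
  | 0, _ => 1
  | j + 1, t => C (1 - j * t) * (derivative g * powDerivFactor g j t) +
      C t * (g * derivative (powDerivFactor g j t))

theorem isContinuousFamily_powDerivFactor (g : ℂ[X]) (j : ℕ) :
    IsContinuousFamily (powDerivFactor g j) := by
  induction j with
  | zero => exact .const 1
  | succ j ih =>
    exact (IsContinuousFamily.C_comp (by fun_prop)).mul ((IsContinuousFamily.const _).mul ih)
      |>.add ((IsContinuousFamily.C_comp continuous_id).mul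
        ((IsContinuousFamily.const _).mul ih.derivative))

theorem powDerivFactor_zero_right (g : ℂ[X]) (j : ℕ) :
    powDerivFactor g j 0 = derivative g ^ j := by
  induction j with
  | zero => simp [powDerivFactor]
  | succ j ih => simp [powDerivFactor, ih, pow_succ']

theorem iterate_derivative_pow_eq (g : ℂ[X]) {m : ℕ} (hm : m ≠ 0) {j : ℕ} (hj : j ≤ m) :
    derivative^[j] (g ^ m) = C ((m : ℂ) ^ j) * (g ^ (m - j) * powDerivFactor g j (m : ℂ)⁻¹) := by
  induction j with
  | zero => simp [powDerivFactor]
  | succ j ih =>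
    obtain ⟨d, rfl⟩ : ∃ d, m = j + 1 + d := ⟨m - (j + 1), by omega⟩
    have hm' : ((j + 1 + d : ℕ) : ℂ) ≠ 0 := Nat.cast_ne_zero.2 hm
    rw [Function.iterate_succ_apply', ih (by omega), show j + 1 + d - j = d + 1 by omega,
      show j + 1 + d - (j + 1) = d by omega, powDerivFactor]
    generalize powDerivFactor g j _ = R
    have h1 : C (((j + 1 + d : ℕ) : ℂ) ^ (j + 1)) * C (1 - j * ((j + 1 + d : ℕ) : ℂ)⁻¹) =
        C (((j + 1 + d : ℕ) : ℂ) ^ j) * C ((d : ℂ) + 1) := by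
      rw [← C_mul, ← C_mul, pow_succ, mul_assoc, mul_sub, mul_left_comm, mul_inv_cancel₀ hm']
      push_cast
      ring_nf
    have h2 : C (((j + 1 + d : ℕ) : ℂ) ^ (j + 1)) * C (((j + 1 + d : ℕ) : ℂ)⁻¹) =
        C (((j + 1 + d : ℕ) : ℂ) ^ j) := by
      rw [← C_mul, pow_succ, mul_assoc, mul_inv_cancel₀ hm', mul_one]
    rw [derivative_C_mul, derivative_mul, derivative_pow_succ]
    linear_combination (-g ^ d * derivative g * R) * h1 - g ^ d * g * derivative R * h2

end Polynomial

/-- The polynomials `F t` such that `T (g ^ m) = m ^ k * g ^ (m - k) * F (1 / m)`. -/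
noncomputable def diffOpPowFactor (k : ℕ) (Q : ℕ → ℂ[X]) (g : ℂ[X]) (t : ℂ) : ℂ[X] :=
  ∑ j ∈ Finset.range (k + 1), C (t ^ (k - j)) * (Q j * g ^ (k - j) * powDerivFactor g j t)

theorem isContinuousFamily_diffOpPowFactor (k : ℕ) (Q : ℕ → ℂ[X]) (g : ℂ[X]) :
    IsContinuousFamily (diffOpPowFactor k Q g) :=
  .sum _ fun j _ => (IsContinuousFamily.C_comp (by fun_prop)).mul
    ((IsContinuousFamily.const _).mul (isContinuousFamily_powDerivFactor g j))

theorem diffOpPowFactor_zero_right (k : ℕ) (Q : ℕ → ℂ[X]) (g : ℂ[X]) :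
    diffOpPowFactor k Q g 0 = Q k * derivative g ^ k := by
  rw [diffOpPowFactor, Finset.sum_eq_single k]
  · simp [powDerivFactor_zero_right]
  · intro j hj hjk
    have : k - j ≠ 0 := by have := Finset.mem_range.1 hj; omega
    simp [this]
  · simp

theorem diffOp_pow (k : ℕ) (Q : ℕ → ℂ[X]) (g : ℂ[X]) {m : ℕ} (hm : m ≠ 0) (hkm : k ≤ m) :
    diffOp k Q (g ^ m) = C ((m : ℂ) ^ k) * g ^ (m - k) * diffOpPowFactor k Q g (m : ℂ)⁻¹ := by
  rw [diffOp, diffOpPowFactor, Finset.mul_sum]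
  refine Finset.sum_congr rfl fun j hj => ?_
  have hj : j ≤ k := Nat.lt_succ_iff.1 (Finset.mem_range.1 hj)
  have hm' : (m : ℂ) ≠ 0 := Nat.cast_ne_zero.2 hm
  have hC : C ((m : ℂ) ^ k) * C ((m : ℂ)⁻¹ ^ (k - j)) = C ((m : ℂ) ^ j) := by
    rw [← C_mul]
    congr 1
    obtain ⟨d, rfl⟩ := Nat.exists_eq_add_of_le hj
    rw [Nat.add_sub_cancel_left, pow_add, mul_assoc, ← mul_pow, mul_inv_cancel₀ hm', one_pow,
      mul_one]
  have hg : g ^ (m - k) * g ^ (k - j) = g ^ (m - j) := by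
    rw [← pow_add]
    congr 1
    omega
  rw [iterate_derivative_pow_eq g hm (hj.trans hkm), ← hC, ← hg]
  ring

/-- If all zeros of a nonconstant polynomial `g` lie in a closed invariant set, so do those of
`Q k * (derivative g) ^ k`. -/
theorem TGeInvariant.root_mem {k n : ℕ} {Q : ℕ → ℂ[X]} {S : Set ℂ}
    (hinv : TGeInvariant (diffOp k Q) n S) (hQ : Q k ≠ 0) (hS : IsClosed S) {g : ℂ[X]}
    (hg : 1 ≤ g.natDegree) (hroot : ∀ z, g.eval z = 0 → z ∈ S) {w : ℂ}
    (hw : (Q k * derivative g ^ k).eval w = 0) : w ∈ S := by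
  have hg0 : g ≠ 0 := by
    rintro rfl
    simp at hg
  have hg' : derivative g ≠ 0 := by
    intro h
    have := derivative_eq_zero.1 h
    omega
  refine (isContinuousFamily_diffOpPowFactor k Q g).root_mem_of_tendsto
    (by simp [diffOpPowFactor_zero_right, hQ, hg']) hS
    (t := fun m : ℕ => (m : ℂ)⁻¹) tendsto_inv_atTop_nhds_zero_nat ?_
    (by rwa [diffOpPowFactor_zero_right])
  filter_upwards [Filter.eventually_ge_atTop (max (max k n) 1)] with m hm
  have hkm : k ≤ m := by omega
  have hm0 : m ≠ 0 := by omega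
  have hdeg : n ≤ (g ^ m).natDegree := by
    rw [natDegree_pow]
    nlinarith [show n ≤ m by omega]
  have hT := hinv (g ^ m) (pow_ne_zero m hg0) hdeg fun z hz =>
    hroot z (by simpa [hm0] using hz)
  rw [diffOp_pow k Q g hm0 hkm] at hT
  refine hT.imp (fun h => ?_) fun h z hz => h z (by simp [hz])
  simpa [hm0, hg0] using h

theorem TGe_invariant_minimal_element (k : ℕ) (hk : 1 ≤ k)
    (Q : ℕ → Polynomial ℂ) (hQk : 1 ≤ (Q k).natDegree) (n : ℕ)
    (M : Set ℂ)
    (hM : M = ⋂₀ {S : Set ℂ | S.Nonempty ∧ IsClosed S ∧ TGeInvariant (diffOp k Q) n S}) :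
    M.Nonempty ∧ convexHull ℝ {z : ℂ | (Q k).eval z = 0} ⊆ M ∧ IsClosed M ∧
      TGeInvariant (diffOp k Q) n M ∧
      ∀ S : Set ℂ, S.Nonempty → IsClosed S → TGeInvariant (diffOp k Q) n S → M ⊆ S := by
  have hQ0 : Q k ≠ 0 := by
    intro h
    simp [h] at hQk
  have hsub : convexHull ℝ {z : ℂ | (Q k).eval z = 0} ⊆ M := by
    rw [hM]
    refine Set.subset_sInter ?_
    rintro S ⟨⟨a, ha⟩, hS, hinv⟩
    refine convexHull_min (fun w hw => ?_) (hS.convex_of_midpoint_mem fun a ha b hb => ?_)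
    · refine hinv.root_mem hQ0 hS (g := X - C a) (by simp) (fun z hz => ?_) ?_
      · rw [eval_sub, eval_X, eval_C, sub_eq_zero] at hz
        rwa [hz]
      · rw [eval_mul, show (Q k).eval w = 0 from hw, zero_mul]
    · refine hinv.root_mem hQ0 hS (g := (X - C a) * (X - C b)) ?_ (fun z hz => ?_) ?_
      · rw [natDegree_mul (X_sub_C_ne_zero a) (X_sub_C_ne_zero b)]
        simp
      · simp only [eval_mul, eval_sub, eval_X, eval_C, mul_eq_zero, sub_eq_zero] at hz
        rcases hz with rfl | rfl <;> assumption
      · have : (derivative ((X - C a) * (X - C b))).eval ((2⁻¹ : ℝ) • (a + b)) = 0 := by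
          simp [derivative_mul]
          ring
        rw [eval_mul, eval_pow, this, zero_pow (by omega), mul_zero]
  obtain ⟨w, hw⟩ := Complex.exists_root (f := Q k) (natDegree_pos_iff_degree_pos.1 hQk)
  refine ⟨⟨w, hsub (subset_convexHull ℝ _ hw)⟩, hsub, ?_, ?_, ?_⟩
  · rw [hM]
    exact isClosed_sInter fun S hS => hS.2.1
  · intro p hp hn hroot
    refine or_iff_not_imp_left.2 fun hT z hz => ?_
    rw [hM] at hroot ⊢
    exact fun S hS => (hS.2.2 p hp hn fun x hx => hroot x hx S hS).resolve_left hT z hz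
  · intro S hne hS hinv
    rw [hM]
    exact Set.sInter_subset_of_mem ⟨hne, hS, hinv⟩
end

section
/- Let k ≥ 1 and let Q_0, …, Q_k ∈ ℂ[x] with Q_k ≠ 0, let T(p) = ∑_{j=0}^k Q_j · p^{(j)}, and assume T is non-degenerate, i.e. deg Q_j − j ≤ deg Q_k − k for all 0 ≤ j ≤ k with Q_j ≠ 0. Then there exist a positive integer N_0 and a real number R_0 > 0 such that for every integer n ≥ N_0 and every real R ≥ R_0, the closed disk {z ∈ ℂ : |z| ≤ R} is T_n-invariant. -/
open Polynomial

/-- A set `S ⊆ ℂ` is `T_n`-invariant: for every nonzero polynomial `p` with `deg p = n`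
all of whose zeros lie in `S`, either `T p = 0` or all zeros of `T p` lie in `S`. -/
def TnInvariant (T : Polynomial ℂ → Polynomial ℂ) (n : ℕ) (S : Set ℂ) : Prop :=
  ∀ p : Polynomial ℂ, p ≠ 0 → p.natDegree = n → (∀ z : ℂ, p.eval z = 0 → z ∈ S) →
    T p = 0 ∨ ∀ z : ℂ, (T p).eval z = 0 → z ∈ S

/-- `T` is non-degenerate: `deg Q_j − j ≤ deg Q_k − k` for all `0 ≤ j ≤ k` with `Q_j ≠ 0`. -/
def NonDegenerate (k : ℕ) (Q : ℕ → Polynomial ℂ) : Prop :=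
  ∀ j ≤ k, Q j ≠ 0 → ((Q j).natDegree : ℤ) - j ≤ ((Q k).natDegree : ℤ) - k

lemma one_half_le_re_div_sub {z w : ℂ} (hw : ‖w‖ ≤ ‖z‖) (hzw : z - w ≠ 0) :
    1 / 2 ≤ (z / (z - w)).re := by
  have hpos : 0 < Complex.normSq (z - w) := Complex.normSq_pos.mpr hzw
  have hsq : Complex.normSq w ≤ Complex.normSq z := by
    rw [Complex.normSq_eq_norm_sq, Complex.normSq_eq_norm_sq]
    gcongr
  rw [Complex.div_re, ← add_div, le_div_iff₀ hpos]
  simp only [Complex.normSq_apply, Complex.sub_re, Complex.sub_im] at *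
  linarith

/-- If no zero of `p` has modulus larger than `|z|`, then `deg p · |p(z)| ≤ 2 |z| |p'(z)|`. -/
lemma natDegree_mul_norm_eval_le {p : ℂ[X]} {z : ℂ} (hroots : ∀ w, p.eval w = 0 → ‖w‖ ≤ ‖z‖) :
    p.natDegree * ‖p.eval z‖ ≤ 2 * ‖z‖ * ‖p.derivative.eval z‖ := by
  by_cases hz : p.eval z = 0
  · rw [hz, norm_zero, mul_zero]
    positivity
  have hsplits := IsAlgClosed.splits p
  have hderiv := hsplits.eval_derivative_div_eval_of_ne_zero hz
  have hre : (p.natDegree : ℝ) / 2 ≤ (z * (p.derivative.eval z / p.eval z)).re := by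
    rw [hderiv, ← Multiset.sum_map_mul_left, ← Complex.coe_reAddGroupHom, map_multiset_sum,
      Multiset.map_map]
    have hsum := Multiset.card_nsmul_le_sum
      (s := p.roots.map (Complex.reAddGroupHom ∘ fun w ↦ z * (1 / (z - w)))) (a := (1 / 2 : ℝ)) ?_
    · rw [Multiset.card_map, ← hsplits.natDegree_eq_card_roots, nsmul_eq_mul] at hsum
      linarith
    · intro x hx
      obtain ⟨w, hw, rfl⟩ := Multiset.mem_map.mp hx
      have hw0 : p.eval w = 0 := (Polynomial.mem_roots'.mp hw).2
      have hzw : z - w ≠ 0 := fun h ↦ hz (by rwa [sub_eq_zero.mp h])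
      simpa [div_eq_mul_inv] using one_half_le_re_div_sub (hroots w hw0) hzw
  have hnorm := hre.trans (Complex.re_le_norm _)
  rw [norm_mul, norm_div, ← mul_div_assoc, div_le_div_iff₀ two_pos (norm_pos_iff.mpr hz)] at hnorm
  linarith

lemma natDegree_iterate_derivative_eq (p : ℂ[X]) (j : ℕ) :
    (derivative^[j] p).natDegree = p.natDegree - j := by
  induction j with
  | zero => rfl
  | succ j ih => rw [Function.iterate_succ_apply', natDegree_derivative, ih, Nat.sub_sub]

/-- Zeros of derivatives of `p` of order at most `deg p` stay in any centered disk containing the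
zeros of `p`. -/
lemma norm_le_of_eval_iterate_derivative_eq_zero {p : ℂ[X]} {R : ℝ}
    (hroots : ∀ w, p.eval w = 0 → ‖w‖ ≤ R) {j : ℕ} (hj : j ≤ p.natDegree) {w : ℂ}
    (hw : (derivative^[j] p).eval w = 0) : ‖w‖ ≤ R := by
  induction j generalizing w with
  | zero => exact hroots w hw
  | succ j ih =>
    by_contra! hlt
    have hbound := natDegree_mul_norm_eval_le (p := derivative^[j] p) (z := w)
      fun u hu ↦ (ih (by omega) hu).trans hlt.le
    rw [← Function.iterate_succ_apply' (⇑derivative), hw, natDegree_iterate_derivative_eq, norm_zero,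
      mul_zero] at hbound
    have hne : (derivative^[j] p).eval w ≠ 0 := fun h ↦ hlt.not_ge (ih (by omega) h)
    have hdeg : (0 : ℝ) < (p.natDegree - j : ℕ) := by exact_mod_cast (by omega)
    exact hbound.not_gt (mul_pos hdeg (norm_pos_iff.mpr hne))

/-- Comparison of a derivative of `p` with a higher one outside a disk containing the zeros. -/
lemma mul_norm_eval_iterate_derivative_le {p : ℂ[X]} {R : ℝ}
    (hroots : ∀ w, p.eval w = 0 → ‖w‖ ≤ R) {z : ℂ} (hz : R < ‖z‖) {M : ℕ} (hM : 2 ≤ M)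
    (i j : ℕ) (hij : M + j + i ≤ p.natDegree) :
    M * ‖(derivative^[j] p).eval z‖ ≤
      2 * ‖z‖ ^ (i + 1) * ‖(derivative^[j + (i + 1)] p).eval z‖ := by
  have hstep (l : ℕ) (hl : M + l ≤ p.natDegree) :
      M * ‖(derivative^[l] p).eval z‖ ≤ 2 * ‖z‖ * ‖(derivative^[l + 1] p).eval z‖ := by
    have hbound := natDegree_mul_norm_eval_le (p := derivative^[l] p) (z := z) fun u hu ↦
      (norm_le_of_eval_iterate_derivative_eq_zero hroots (by omega) hu).trans hz.le
    rw [← Function.iterate_succ_apply' (⇑derivative), natDegree_iterate_derivative_eq] at hbound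
    refine le_trans ?_ hbound
    gcongr
    omega
  induction i with
  | zero => simpa using hstep j hij
  | succ i ih =>
    have hM' : (2 : ℝ) ≤ M := by exact_mod_cast hM
    have hlast := hstep (j + (i + 1)) (by omega)
    have hnext : ‖(derivative^[j + (i + 1)] p).eval z‖ ≤
        ‖z‖ * ‖(derivative^[j + (i + 1) + 1] p).eval z‖ := by
      nlinarith [norm_nonneg ((derivative^[j + (i + 1)] p).eval z)]
    calc M * ‖(derivative^[j] p).eval z‖
        ≤ 2 * ‖z‖ ^ (i + 1) * ‖(derivative^[j + (i + 1)] p).eval z‖ := ih (by omega)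
      _ ≤ 2 * ‖z‖ ^ (i + 1) * (‖z‖ * ‖(derivative^[j + (i + 1) + 1] p).eval z‖) := by gcongr
      _ = 2 * ‖z‖ ^ (i + 1 + 1) * ‖(derivative^[j + (i + 1 + 1)] p).eval z‖ := by
        rw [← add_assoc j (i + 1) 1]
        ring

lemma exists_norm_eval_le_of_degree_le {P Q : ℂ[X]} (h : P.degree ≤ Q.degree) :
    ∃ C : ℝ, 0 ≤ C ∧ ∃ r : ℝ, ∀ z : ℂ, r < ‖z‖ → ‖P.eval z‖ ≤ C * ‖Q.eval z‖ := by
  obtain ⟨C, hC, hbound⟩ := (isBigO_cobounded_of_degree_le h).exists_nonneg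
  obtain ⟨r, -, hr⟩ := (Filter.hasBasis_cobounded_norm (E := ℂ)).eventually_iff.mp hbound.bound
  exact ⟨C, hC, r, fun z hz ↦ hr hz.le⟩

/-- For a non-degenerate operator, `|Q_j(z)| |z|^{k-j}` is dominated by `|Q_k(z)|`. -/
lemma NonDegenerate.exists_norm_eval_mul_pow_le {k : ℕ} {Q : ℕ → ℂ[X]} (hQk : Q k ≠ 0)
    (hnd : NonDegenerate k Q) (j : ℕ) :
    ∃ C : ℝ, 0 ≤ C ∧ ∃ r : ℝ, j ≤ k → ∀ z : ℂ, r < ‖z‖ →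
      ‖(Q j).eval z‖ * ‖z‖ ^ (k - j) ≤ C * ‖(Q k).eval z‖ := by
  by_cases hj : j ≤ k
  · have hdeg : (Q j * X ^ (k - j)).degree ≤ (Q k).degree := by
      by_cases hQj : Q j = 0
      · simp [hQj]
      · have hle := hnd j hj hQj
        rw [degree_mul, degree_X_pow, degree_eq_natDegree hQj, degree_eq_natDegree hQk]
        exact_mod_cast (by omega : (Q j).natDegree + (k - j) ≤ (Q k).natDegree)
    obtain ⟨C, hC, r, hr⟩ := exists_norm_eval_le_of_degree_le hdeg
    exact ⟨C, hC, r, fun _ z hz ↦ by simpa using hr z hz⟩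
  · exact ⟨0, le_rfl, 0, fun h ↦ absurd h hj⟩

theorem nondegenerate_large_disks_invariant (k : ℕ) (hk : 1 ≤ k) (Q : ℕ → Polynomial ℂ)
    (hQk : Q k ≠ 0) (hnd : NonDegenerate k Q) :
    ∃ N₀ : ℕ, 0 < N₀ ∧ ∃ R₀ : ℝ, 0 < R₀ ∧ ∀ n : ℕ, N₀ ≤ n → ∀ R : ℝ, R₀ ≤ R →
      TnInvariant (diffOp k Q) n (Metric.closedBall (0 : ℂ) R) := by
  choose C hC r hr using hnd.exists_norm_eval_mul_pow_le hQk
  obtain ⟨C₁, -, r₁, hr₁⟩ := exists_norm_eval_le_of_degree_le (P := 1) (Q := Q k)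
    (by simpa using zero_le_degree_iff.mpr hQk)
  obtain ⟨M, hM⟩ := exists_nat_gt (∑ j ∈ Finset.range k, 2 * C j)
  set S : ℝ := ∑ j ∈ Finset.range k, |r j|
  have hS : 0 ≤ S := Finset.sum_nonneg fun j _ ↦ abs_nonneg (r j)
  refine ⟨M + 2 + k, by omega, 1 + |r₁| + S, by positivity, ?_⟩
  intro n hn R hR p _ hpn hroots
  have hroots' : ∀ w, p.eval w = 0 → ‖w‖ ≤ R := fun w hw ↦ by simpa using hroots w hw
  refine Or.inr fun z hTz ↦ ?_
  rw [mem_closedBall_zero_iff]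
  by_contra! hz
  have hQz : (Q k).eval z ≠ 0 := by
    intro h
    have hone := hr₁ z (by linarith [le_abs_self r₁])
    norm_num [h] at hone
  have hpz : (derivative^[k] p).eval z ≠ 0 := fun h ↦
    hz.not_ge (norm_le_of_eval_iterate_derivative_eq_zero hroots' (by omega) h)
  set A : ℝ := ‖(Q k).eval z‖ * ‖(derivative^[k] p).eval z‖ with hA
  have hApos : 0 < A := mul_pos (norm_pos_iff.mpr hQz) (norm_pos_iff.mpr hpz)
  have hterm : ∀ j ∈ Finset.range k,
      ((M + 2 : ℕ) : ℝ) * ‖(Q j * derivative^[j] p).eval z‖ ≤ 2 * C j * A := by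
    intro j hj
    have hjk := Finset.mem_range.mp hj
    have hrj : r j < ‖z‖ := by
      have := Finset.single_le_sum (f := fun j ↦ |r j|) (fun j _ ↦ abs_nonneg (r j)) hj
      linarith [le_abs_self (r j), abs_nonneg r₁]
    have hder := mul_norm_eval_iterate_derivative_le hroots' hz (M := M + 2) (by omega)
      (k - j - 1) j (by omega)
    rw [show k - j - 1 + 1 = k - j by omega, show j + (k - j) = k by omega] at hder
    rw [eval_mul, norm_mul]
    calc ((M + 2 : ℕ) : ℝ) * (‖(Q j).eval z‖ * ‖(derivative^[j] p).eval z‖)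
        = ‖(Q j).eval z‖ * (((M + 2 : ℕ) : ℝ) * ‖(derivative^[j] p).eval z‖) := by ring
      _ ≤ ‖(Q j).eval z‖ * (2 * ‖z‖ ^ (k - j) * ‖(derivative^[k] p).eval z‖) := by gcongr
      _ = 2 * (‖(Q j).eval z‖ * ‖z‖ ^ (k - j)) * ‖(derivative^[k] p).eval z‖ := by ring
      _ ≤ 2 * (C j * ‖(Q k).eval z‖) * ‖(derivative^[k] p).eval z‖ := by
        have := hr j hjk.le z hrj
        gcongr 2 * ?_ * _
      _ = 2 * C j * A := by rw [hA]; ring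
  have hAle : A ≤ ∑ j ∈ Finset.range k, ‖(Q j * derivative^[j] p).eval z‖ := by
    rw [diffOp, Finset.sum_range_succ, eval_add, eval_finsetSum] at hTz
    rw [hA, ← norm_mul, ← eval_mul, eq_neg_of_add_eq_zero_right hTz, norm_neg]
    exact norm_sum_le _ _
  have hcontra : ((M + 2 : ℕ) : ℝ) * A ≤ (∑ j ∈ Finset.range k, 2 * C j) * A := by
    calc ((M + 2 : ℕ) : ℝ) * A
        ≤ ((M + 2 : ℕ) : ℝ) * ∑ j ∈ Finset.range k, ‖(Q j * derivative^[j] p).eval z‖ := by gcongr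
      _ ≤ (∑ j ∈ Finset.range k, 2 * C j) * A := by
        rw [Finset.mul_sum, Finset.sum_mul]
        exact Finset.sum_le_sum hterm
  have hlarge := le_of_mul_le_mul_right hcontra hApos
  push_cast at hlarge
  linarith
end
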